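/- arXiv:1802.08097 — 6 statements merged into one kernel-verified Lean document; each statement's English description precedes it below -/
import Mathlib

section
/- For all integers 1 ≤ k ≤ n and every λ ∈ Y_{k,n}, the orbit length o(λ) divides n, and the quotient n/o(λ) divides gcd(k,n). -/
/-- A Young diagram inscribed in a `k × (n-k)` rectangle: a weakly decreasing
sequence `λ₁ ≥ … ≥ λ_k` (0-indexed) with all entries `≤ n - k`. -/
def IsDiagram (k n : ℕ) (lam : Fin k → ℕ) : Prop :=
  (∀ i j : Fin k, i ≤ j → lam j ≤ lam i) ∧ ∀ i, lam i ≤ n - k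

/-- The cyclic step map `σ` on diagrams: add one box to every row if the first
row is shorter than `n - k`, otherwise drop the first row and append a zero row. -/
def cyc (k n : ℕ) (lam : Fin k → ℕ) : Fin k → ℕ :=
  if ∀ i, lam i < n - k then fun i => lam i + 1
  else fun i => if h : (i : ℕ) + 1 < k then lam ⟨(i : ℕ) + 1, h⟩ else 0

/-- The orbit length `o(λ)`: the least positive `t` with `σ^[t] λ = λ`. -/
noncomputable def orbLen (k n : ℕ) (lam : Fin k → ℕ) : ℕ :=
  sInf {t | 0 < t ∧ (cyc k n)^[t] lam = lam}

/-- Upper triangular diagram: `k·λᵢ ≤ (n-k)(k-i)` for all `i` (1-indexed). -/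
def IsUpper (k n : ℕ) (lam : Fin k → ℕ) : Prop :=
  ∀ i : Fin k, k * lam i ≤ (n - k) * (k - 1 - (i : ℕ))

/-- Lexicographic (non-strict) comparison of diagrams. -/
def lexLE {k : ℕ} (lam mu : Fin k → ℕ) : Prop :=
  lam = mu ∨ ∃ t : Fin k, (∀ i, i < t → lam i = mu i) ∧ lam t < mu t

/-- Minimal upper triangular diagram: upper triangular and lexicographically
smallest among the upper triangular diagrams in its `σ`-orbit. -/
def IsMinUpper (k n : ℕ) (lam : Fin k → ℕ) : Prop :=
  IsUpper k n lam ∧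
    ∀ t : ℕ, IsUpper k n ((cyc k n)^[t] lam) → lexLE lam ((cyc k n)^[t] lam)

/-- The binary word of a diagram: position `j` (0-indexed) carries the symbol `0`
(encoded as `false`) iff `j = λ_{k-i} + i` for some `0 ≤ i ≤ k-1` (0-indexed). -/
def word (k n : ℕ) (lam : Fin k → ℕ) (j : Fin n) : Bool :=
  !decide (∃ i : Fin k, (j : ℕ) = lam i.rev + (i : ℕ))

/-- A binary word of length `n` with exactly `k` zeros (`false` encodes `0`). -/
def IsWord (k n : ℕ) (w : Fin n → Bool) : Prop :=
  (Finset.univ.filter fun j => w j = false).card = k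

/-- Rotation of a binary word: `r(w)_j = w_{j+1}`, indices mod `n`. -/
def rot {n : ℕ} (w : Fin n → Bool) (j : Fin n) : Bool :=
  w ⟨((j : ℕ) + 1) % n, Nat.mod_lt _ j.pos⟩

/-- The diagram `θ_{k,km} = ((k-1)(m-1), (k-2)(m-1), …, (m-1), 0)`. -/
def theta (k m : ℕ) : Fin k → ℕ := fun i => (k - 1 - (i : ℕ)) * (m - 1)

/-- `N_{k,n}`: the number of diagrams in `Y_{k,n}` with full orbit `o(λ) = n`. -/
noncomputable def NN (k n : ℕ) : ℕ :=
  {lam : Fin k → ℕ | IsDiagram k n lam ∧ orbLen k n lam = n}.ncard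

theorem orbLen_eq_minimalPeriod {k n : ℕ} {lam : Fin k → ℕ}
    (h : lam ∈ Function.periodicPts (cyc k n)) :
    orbLen k n lam = Function.minimalPeriod (cyc k n) lam := by
  have hpos := Function.minimalPeriod_pos_of_mem_periodicPts h
  have hmem : Function.minimalPeriod (cyc k n) lam ∈
      {t | 0 < t ∧ (cyc k n)^[t] lam = lam} :=
    ⟨hpos, Function.isPeriodicPt_minimalPeriod _ _⟩
  refine le_antisymm (Nat.sInf_le hmem) ?_
  obtain ⟨h0, h1⟩ := Nat.sInf_mem ⟨_, hmem⟩
  exact Function.IsPeriodicPt.minimalPeriod_le h0 h1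

theorem IsDiagram.cyc {k n : ℕ} {lam : Fin k → ℕ} (h : IsDiagram k n lam) :
    IsDiagram k n (cyc k n lam) := by
  obtain ⟨h1, h2⟩ := h
  unfold _root_.cyc
  split_ifs with hc
  · exact ⟨fun i j hij => Nat.succ_le_succ (h1 i j hij), hc⟩
  · refine ⟨fun i j hij => ?_, fun i => ?_⟩
    · rw [Fin.le_def] at hij
      dsimp only
      split_ifs
      · exact h1 _ _ (by rw [Fin.le_def]; simpa using hij)
      · omega
      · exact Nat.zero_le _
      · exact le_rfl
    · dsimp only
      split_ifs
      · exact h2 _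
      · exact Nat.zero_le _

theorem IsDiagram.iterate_cyc {k n : ℕ} {lam : Fin k → ℕ} (h : IsDiagram k n lam) (t : ℕ) :
    IsDiagram k n ((_root_.cyc k n)^[t] lam) := by
  induction t with
  | zero => exact h
  | succ t ih => rw [Function.iterate_succ_apply']; exact ih.cyc

/-- The quasi-periodic extension of a diagram: every block of `k` further rows is
obtained from the previous one by subtracting `n - k`. -/
def extendRows {k : ℕ} (n : ℕ) (hk : 0 < k) (lam : Fin k → ℕ) (j : ℕ) : ℤ :=
  (lam ⟨j % k, Nat.mod_lt j hk⟩ : ℤ) - (j / k : ℕ) * (n - k : ℕ)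

section extendRows

variable {k n : ℕ} (hk : 0 < k) {lam : Fin k → ℕ}

theorem extendRows_val (i : Fin k) : extendRows n hk lam i = lam i := by
  simp [extendRows, Nat.mod_eq_of_lt i.2, Nat.div_eq_of_lt i.2]

theorem extendRows_add_self (j : ℕ) :
    extendRows n hk lam (j + k) = extendRows n hk lam j - (n - k : ℕ) := by
  simp only [extendRows, Nat.add_mod_right, Nat.add_div_right j hk]
  push_cast
  ring

theorem IsDiagram.extendRows_succ_le (h : IsDiagram k n lam) (j : ℕ) :
    extendRows n hk lam (j + 1) ≤ extendRows n hk lam j := by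
  induction j using Nat.strong_induction_on with
  | _ j ih =>
    rcases lt_trichotomy (j + 1) k with hj | hj | hj
    · have h1 := extendRows_val (n := n) hk (lam := lam) ⟨j, by omega⟩
      have h2 := extendRows_val (n := n) hk (lam := lam) ⟨j + 1, hj⟩
      dsimp only at h1 h2
      rw [h1, h2]
      exact_mod_cast h.1 ⟨j, by omega⟩ ⟨j + 1, hj⟩ (by simp [Fin.le_def])
    · have h1 := extendRows_val (n := n) hk (lam := lam) ⟨j, by omega⟩
      have h2 := extendRows_val (n := n) hk (lam := lam) ⟨0, hk⟩
      have h3 := extendRows_add_self (n := n) hk (lam := lam) 0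
      have h4 := h.2 ⟨0, hk⟩
      rw [zero_add] at h3
      dsimp only at h1 h2
      rw [hj, h1, h3, h2]
      omega
    · obtain ⟨i, rfl⟩ : ∃ i, j = i + k := ⟨j - k, by omega⟩
      rw [show i + k + 1 = i + 1 + k by ring, extendRows_add_self, extendRows_add_self]
      have := ih i (by omega)
      omega

theorem IsDiagram.strictAnti_extendRows_sub (h : IsDiagram k n lam) :
    StrictAnti fun j : ℕ => extendRows n hk lam j - j := by
  refine strictAnti_nat_of_succ_lt fun j => ?_
  have := h.extendRows_succ_le hk j
  push_cast
  omega

/-- After `t` steps the diagram is a window of the extension of the original one,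
shifted by `b` rows and raised by `a` boxes, with `a + b = t`. -/
theorem IsDiagram.exists_iterate_cyc_eq (h : IsDiagram k n lam) (t : ℕ) :
    ∃ a b : ℕ, a + b = t ∧
      ∀ i : Fin k, ((_root_.cyc k n)^[t] lam i : ℤ) = extendRows n hk lam (i + b) + a := by
  induction t with
  | zero => exact ⟨0, 0, rfl, fun i => by simp [extendRows_val]⟩
  | succ t ih =>
    obtain ⟨a, b, hab, hi⟩ := ih
    have hd := h.iterate_cyc t
    rw [Function.iterate_succ_apply']
    generalize (_root_.cyc k n)^[t] lam = mu at hi hd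
    by_cases hc : ∀ i, mu i < n - k
    · refine ⟨a + 1, b, by omega, fun i => ?_⟩
      have := hi i
      simp only [_root_.cyc, if_pos hc]
      push_cast
      omega
    · refine ⟨a, b + 1, by omega, fun i => ?_⟩
      simp only [_root_.cyc, if_neg hc]
      split_ifs with hik
      · rw [hi, show (i : ℕ) + 1 + b = i + (b + 1) by ring]
      · push Not at hc
        obtain ⟨r, hr⟩ := hc
        have h1 := hd.1 ⟨0, hk⟩ r (by simp [Fin.le_def])
        have h2 := hd.2 ⟨0, hk⟩
        have h3 := hi ⟨0, hk⟩
        dsimp only at h3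
        rw [zero_add] at h3
        rw [show (i : ℕ) + (b + 1) = b + k by omega, extendRows_add_self]
        push_cast
        omega

theorem IsDiagram.iterate_cyc_self (hk : 0 < k) (hkn : k ≤ n) (h : IsDiagram k n lam) :
    (_root_.cyc k n)^[n] lam = lam := by
  obtain ⟨a, b, hab, hi⟩ := h.exists_iterate_cyc_eq hk n
  have hanti := (h.strictAnti_extendRows_sub hk).antitone
  have h0 := extendRows_val (n := n) hk (lam := lam) ⟨0, hk⟩
  have hl0 := h.2 ⟨0, hk⟩
  have hb : b = k := by
    refine le_antisymm ?_ ?_ <;> by_contra! hlt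
    · have h1 := hi ⟨k - 1, by omega⟩
      have h2 := hanti (show k + k ≤ k - 1 + b by omega)
      have h3 := extendRows_add_self (n := n) hk (lam := lam) k
      have h4 := extendRows_add_self (n := n) hk (lam := lam) 0
      rw [zero_add] at h4
      dsimp only at h0 h1 h2
      push_cast at h2
      omega
    · have h1 := hi ⟨0, hk⟩
      have h2 := (h.iterate_cyc n).2 ⟨0, hk⟩
      have h3 := hanti (show b ≤ k - 1 by omega)
      have h4 := extendRows_val (n := n) hk (lam := lam) ⟨k - 1, by omega⟩
      dsimp only at h1 h3 h4
      rw [zero_add] at h1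
      omega
  subst hb
  ext i
  have h1 := hi i
  rw [extendRows_add_self, extendRows_val] at h1
  omega

theorem extendRows_eq_add_mul {a b : ℕ}
    (h : ∀ i : Fin k, (lam i : ℤ) = extendRows n hk lam (i + b) + a) (m j : ℕ) :
    extendRows n hk lam j = extendRows n hk lam (j + m * b) + m * a := by
  have hone : ∀ j, extendRows n hk lam j = extendRows n hk lam (j + b) + a := by
    intro j
    induction j using Nat.strong_induction_on with
    | _ j ih =>
      by_cases hj : j < k
      · rw [← h ⟨j, hj⟩, ← extendRows_val (n := n) hk ⟨j, hj⟩]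
      · obtain ⟨i, rfl⟩ : ∃ i, j = i + k := ⟨j - k, by omega⟩
        rw [show i + k + b = i + b + k by ring, extendRows_add_self, extendRows_add_self,
          ih i (by omega)]
        ring
  induction m with
  | zero => simp
  | succ m ih =>
    rw [ih, hone (j + m * b), show j + m * b + b = j + (m + 1) * b by ring]
    push_cast
    ring

/-- If `t` steps fix a diagram and `t * m = n`, then `m` divides the number of rows. -/
theorem IsDiagram.dvd_rows_of_iterate_cyc_eq (hk : 0 < k) (hkn : k ≤ n) (h : IsDiagram k n lam) {t m : ℕ}
    (ht : (_root_.cyc k n)^[t] lam = lam) (hm : n = t * m) : m ∣ k := by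
  obtain ⟨a, b, hab, hi⟩ := h.exists_iterate_cyc_eq hk t
  rw [ht] at hi
  have h1 := extendRows_eq_add_mul hk hi m 0
  have h2 := extendRows_add_self (n := n) hk (lam := lam) 0
  rw [zero_add] at h1 h2
  have hn : (n : ℤ) = m * a + m * b := by rw [hm, ← hab]; push_cast; ring
  have hmb : m * b = k := by
    apply (h.strictAnti_extendRows_sub hk).injective
    dsimp only
    push_cast [Nat.cast_sub hkn] at h2 ⊢
    linarith
  exact ⟨b, hmb.symm⟩

end extendRows

/-- for every `λ ∈ Y_{k,n}`, the orbit length `o(λ)` divides `n`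
and `n / o(λ)` divides `gcd(k,n)`. -/
theorem orbLen_dvd_and_quotient_dvd_gcd (k n : ℕ) (hk : 1 ≤ k) (hkn : k ≤ n)
    (lam : Fin k → ℕ) (hlam : IsDiagram k n lam) :
    orbLen k n lam ∣ n ∧ n / orbLen k n lam ∣ Nat.gcd k n := by
  have hn := hlam.iterate_cyc_self hk hkn
  have heq := orbLen_eq_minimalPeriod (Function.mk_mem_periodicPts (by omega) hn)
  obtain ⟨m, hm⟩ := Function.IsPeriodicPt.minimalPeriod_dvd hn
  have hpos : 0 < Function.minimalPeriod (cyc k n) lam :=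
    Nat.pos_of_ne_zero fun h0 => by rw [h0, zero_mul] at hm; omega
  have hdiv : n / Function.minimalPeriod (cyc k n) lam = m :=
    Nat.div_eq_of_eq_mul_right hpos hm
  rw [heq, hdiv]
  exact ⟨⟨m, hm⟩, Nat.dvd_gcd (hlam.dvd_rows_of_iterate_cyc_eq hk hkn
    (Function.isPeriodicPt_minimalPeriod _ _) hm) ⟨_, hm.trans (mul_comm _ _)⟩⟩
end

section
/- For all integers 1 ≤ k ≤ n and every divisor d of gcd(k,n), the sets {λ ∈ Y_{k,n} : o(λ) = n/d} and {μ ∈ Y_{k/d,n/d} : o(μ) = n/d} have the same cardinality. -/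
/-- The positions `λ_i + (k - i)` of the zeros in the binary word of a diagram. -/
def zeroPos {k : ℕ} (lam : Fin k → ℕ) (i : Fin k) : ℕ := lam i + (k - 1 - (i : ℕ))

/-- The `n`-periodic set of integers obtained by unrolling the binary word of a diagram. -/
def unroll (k n : ℕ) (lam : Fin k → ℕ) : Set ℤ := {x | ∃ i, x % n = zeroPos lam i}

/-- Invariance of a set of integers under translation by `t`. -/
def IsPeriod (A : Set ℤ) (t : ℕ) : Prop := ∀ x : ℤ, x ∈ A ↔ x - t ∈ A

/-- The least positive period of a set of integers (`0` if there is none). -/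
noncomputable def minPeriod (A : Set ℤ) : ℕ := sInf {t | 0 < t ∧ IsPeriod A t}

open Classical in
/-- The number of elements of `A` in `[0, n)`. -/
noncomputable def countBelow (A : Set ℤ) (n : ℕ) : ℕ := Nat.count (fun x : ℕ => (x : ℤ) ∈ A) n

theorem IsPeriod.mul {A : Set ℤ} {t : ℕ} (h : IsPeriod A t) (d : ℕ) : IsPeriod A (d * t) := by
  induction d with
  | zero => intro x; simp
  | succ d ih =>
    intro x
    rw [ih x, h (x - (d * t : ℕ))]
    have : x - ((d * t : ℕ) : ℤ) - t = x - ((d + 1) * t : ℕ) := by push_cast; ring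
    rw [this]

theorem IsPeriod.emod_mem {A : Set ℤ} {t : ℕ} (h : IsPeriod A t) (x : ℤ) :
    x % t ∈ A ↔ x ∈ A := by
  have key : ∀ (q : ℕ) (y : ℤ), y ∈ A ↔ y - q * t ∈ A := fun q y => by
    have := h.mul q y
    push_cast at this
    exact this
  have hx := Int.emod_add_mul_ediv x t
  rcases Int.eq_nat_or_neg (x / t) with ⟨q, hq | hq⟩
  · rw [key q x, ← hq]
    have : x - x / t * t = x % t := by linarith
    rw [this]
  · rw [key q (x % t)]
    have h₂ : (q : ℤ) = -(x / t) := by omega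
    have : x % t - q * t = x := by rw [h₂]; linarith
    rw [this]

theorem minPeriod_spec {A : Set ℤ} (h : 0 < minPeriod A) : IsPeriod A (minPeriod A) := by
  have hne : {t | 0 < t ∧ IsPeriod A t}.Nonempty := by
    by_contra hne
    rw [Set.not_nonempty_iff_eq_empty] at hne
    simp [minPeriod, hne] at h
  exact (Nat.sInf_mem hne).2

theorem countBelow_mul {A : Set ℤ} {t : ℕ} (h : IsPeriod A t) (d : ℕ) :
    countBelow A (d * t) = d * countBelow A t := by
  classical
  induction d with
  | zero => simp [countBelow]
  | succ d ih =>
    have hshift (x : ℕ) : ((d * t + x : ℕ) : ℤ) ∈ A ↔ (x : ℤ) ∈ A := by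
      rw [h.mul d]
      simp
    rw [add_mul, one_mul, countBelow, Nat.count_add]
    simp only [hshift]
    change countBelow A (d * t) + countBelow A t = _
    rw [ih]
    ring

theorem isPeriod_unroll (k n : ℕ) (lam : Fin k → ℕ) : IsPeriod (unroll k n lam) n := by
  intro x
  simp [unroll]

theorem IsDiagram.strictAnti_zeroPos {k n : ℕ} {lam : Fin k → ℕ} (h : IsDiagram k n lam) :
    StrictAnti (zeroPos lam) := by
  intro i j hij
  have := h.1 i j hij.le
  have : (i : ℕ) < j := hij
  simp only [zeroPos]
  omega

theorem IsDiagram.zeroPos_lt {k n : ℕ} {lam : Fin k → ℕ} (h : IsDiagram k n lam) (hkn : k ≤ n)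
    (i : Fin k) : zeroPos lam i < n := by
  have := h.2 i
  simp only [zeroPos]
  omega

theorem IsDiagram.mem_unroll_natCast {k n : ℕ} {lam : Fin k → ℕ} (h : IsDiagram k n lam)
    (hkn : k ≤ n) (x : ℕ) :
    x ∈ Set.range (zeroPos lam) ↔ x < n ∧ (x : ℤ) ∈ unroll k n lam := by
  constructor
  · rintro ⟨i, rfl⟩
    have hi := h.zeroPos_lt hkn i
    exact ⟨hi, i, Int.emod_eq_of_lt (Int.natCast_nonneg _) (by exact_mod_cast hi)⟩
  · rintro ⟨hx, i, hi⟩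
    rw [Int.emod_eq_of_lt (by positivity) (by exact_mod_cast hx)] at hi
    exact ⟨i, by exact_mod_cast hi.symm⟩

theorem countBelow_unroll {k n : ℕ} {lam : Fin k → ℕ} (h : IsDiagram k n lam) (hkn : k ≤ n) :
    countBelow (unroll k n lam) n = k := by
  classical
  have himage : (Finset.range n).filter (fun x : ℕ => (x : ℤ) ∈ unroll k n lam) =
      Finset.univ.image (zeroPos lam) := by
    ext x
    rw [Finset.mem_filter, Finset.mem_range, ← h.mem_unroll_natCast hkn]
    simp
  rw [countBelow, Nat.count_eq_card_filter_range]
  convert congrArg Finset.card himage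
  rw [Finset.card_image_of_injective _ h.strictAnti_zeroPos.injective, Finset.card_fin]

theorem unroll_injOn {k n : ℕ} (hkn : k ≤ n) :
    Set.InjOn (unroll k n) {lam | IsDiagram k n lam} := by
  intro lam h mu h' heq
  have hrange : Set.range (zeroPos lam) = Set.range (zeroPos mu) := by
    ext x
    rw [h.mem_unroll_natCast hkn, h'.mem_unroll_natCast hkn, heq]
  have hrev : ∀ f : Fin k → ℕ, Set.range (f ∘ Fin.rev) = Set.range f := fun f =>
    Fin.rev_surjective.range_comp f
  have hcomp : zeroPos lam ∘ Fin.rev = zeroPos mu ∘ Fin.rev := by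
    refine (StrictMono.range_inj ?_ ?_).1 (by rw [hrev, hrev, hrange])
    · exact h.strictAnti_zeroPos.comp Fin.rev_strictAnti
    · exact h'.strictAnti_zeroPos.comp Fin.rev_strictAnti
  funext i
  have := congrFun hcomp i.rev
  simpa [zeroPos] using this

theorem mem_unroll_cyc {k n : ℕ} {lam : Fin k → ℕ} (h : IsDiagram k n lam) (hk : 1 ≤ k)
    (hkn : k ≤ n) (x : ℤ) : x ∈ unroll k n (cyc k n lam) ↔ x - 1 ∈ unroll k n lam := by
  have hn : (0 : ℤ) < n := by omega
  have hr₀ := Int.emod_nonneg (x - 1) hn.ne'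
  have hr₁ := Int.emod_lt_of_pos (x - 1) hn
  have hmod : x % n = if (x - 1) % n + 1 < n then (x - 1) % n + 1 else 0 := by
    have hx : x % n = ((x - 1) % n + 1) % n := by simp
    rw [hx]
    split_ifs with hlt
    · exact Int.emod_eq_of_lt (by omega) hlt
    · have : (x - 1) % n + 1 = n := by omega
      rw [this, Int.emod_self]
  simp only [unroll, Set.mem_ofPred_eq, hmod]
  generalize (x - 1) % (n : ℤ) = r at *
  unfold cyc
  split_ifs with hr hlt hlt
  · refine exists_congr fun i => ?_
    simp only [zeroPos]
    omega
  · constructor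
    · rintro ⟨i, hi⟩
      simp only [zeroPos] at hi
      split_ifs at hi with hik
      · exact ⟨⟨i + 1, hik⟩, by simp only [zeroPos]; omega⟩
      · omega
    · rintro ⟨i, hi⟩
      obtain ⟨i, hik⟩ := i
      rcases i with _ | i
      · exfalso
        refine hlt fun j => lt_of_le_of_lt (h.1 ⟨0, hik⟩ j (Nat.zero_le _)) ?_
        simp only [zeroPos] at hi
        omega
      · refine ⟨⟨i, by omega⟩, ?_⟩
        simp only [zeroPos, hik, dif_pos] at hi ⊢
        omega
  · constructor
    · rintro ⟨i, hi⟩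
      simp only [zeroPos] at hi
      omega
    · rintro ⟨i, hi⟩
      have := hlt i
      simp only [zeroPos] at hi
      omega
  · refine ⟨fun _ => ⟨⟨0, hk⟩, ?_⟩, fun _ => ⟨⟨k - 1, by omega⟩, ?_⟩⟩
    · have hfull : lam ⟨0, hk⟩ = n - k := by
        refine le_antisymm (h.2 _) ?_
        by_contra hcon
        exact hlt fun j => lt_of_le_of_lt (h.1 ⟨0, hk⟩ j (Nat.zero_le _)) (not_le.1 hcon)
      simp only [zeroPos, hfull]
      omega
    · have : ¬ (k - 1 + 1 < k) := by omega
      simp [zeroPos, this]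

theorem mem_unroll_iterate_cyc {k n : ℕ} {lam : Fin k → ℕ} (h : IsDiagram k n lam) (hk : 1 ≤ k)
    (hkn : k ≤ n) (t : ℕ) (x : ℤ) :
    x ∈ unroll k n ((cyc k n)^[t] lam) ↔ x - t ∈ unroll k n lam := by
  induction t generalizing x with
  | zero => simp
  | succ t ih =>
    rw [Function.iterate_succ_apply', mem_unroll_cyc (h.iterate_cyc t) hk hkn, ih]
    have : x - 1 - (t : ℤ) = x - (t + 1 : ℕ) := by push_cast; ring
    rw [this]

theorem minPeriod_unroll {k n : ℕ} {lam : Fin k → ℕ} (h : IsDiagram k n lam) (hk : 1 ≤ k)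
    (hkn : k ≤ n) : minPeriod (unroll k n lam) = orbLen k n lam := by
  unfold minPeriod orbLen
  congr 1
  ext t
  refine and_congr_right fun _ => ?_
  constructor
  · intro hper
    refine unroll_injOn hkn (h.iterate_cyc t) h (Set.ext fun x => ?_)
    rw [mem_unroll_iterate_cyc h hk hkn, ← hper x]
  · intro heq x
    rw [← mem_unroll_iterate_cyc h hk hkn, heq]

theorem StrictMono.add_sub_le_fin {k : ℕ} {f : Fin k → ℕ} (hf : StrictMono f) {i j : Fin k}
    (hij : i ≤ j) : f i + ((j : ℕ) - i) ≤ f j := by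
  obtain ⟨j, hj⟩ := j
  induction j with
  | zero =>
    have : i = ⟨0, hj⟩ := le_antisymm hij (Nat.zero_le _)
    simp [this]
  | succ j ih =>
    rcases hij.eq_or_lt with rfl | hlt
    · simp
    · have hij' : (i : ℕ) < j + 1 := hlt
      have h₁ := ih (by omega) (Nat.lt_succ_iff.1 hij')
      have h₂ : f ⟨j, by omega⟩ < f ⟨j + 1, hj⟩ := hf (Nat.lt_succ_self j)
      dsimp only at h₁ ⊢
      omega

theorem exists_unroll_eq {k n : ℕ} (hk : 1 ≤ k) {A : Set ℤ} (hA : IsPeriod A n)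
    (hcount : countBelow A n = k) : ∃ lam, IsDiagram k n lam ∧ unroll k n lam = A := by
  classical
  set s := (Finset.range n).filter (fun x : ℕ => (x : ℤ) ∈ A) with hs
  have hcard : s.card = k := by
    rw [← hcount, countBelow, Nat.count_eq_card_filter_range]
  have hmem : ∀ x, x ∈ Set.range (s.orderEmbOfFin hcard) ↔ x < n ∧ (x : ℤ) ∈ A := fun x => by
    rw [Finset.range_orderEmbOfFin]
    simp [hs]
  have hmono : StrictMono (s.orderEmbOfFin hcard) := (s.orderEmbOfFin hcard).strictMono
  generalize (s.orderEmbOfFin hcard : Fin k → ℕ) = f at hmem hmono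
  have hlow : ∀ i : Fin k, k - 1 - (i : ℕ) ≤ f i.rev := fun i => by
    have := hmono.add_sub_le_fin (i := ⟨0, hk⟩) (j := i.rev) (Nat.zero_le _)
    simp only [Fin.val_rev] at this
    omega
  have hpos : ∀ i, zeroPos (fun i => f i.rev - (k - 1 - (i : ℕ))) i = f i.rev := fun i =>
    Nat.sub_add_cancel (hlow i)
  refine ⟨fun i => f i.rev - (k - 1 - (i : ℕ)), ⟨fun i j hij => ?_, fun i => ?_⟩, ?_⟩
  · have h₁ := hmono.add_sub_le_fin (Fin.rev_le_rev.2 hij)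
    have h₂ : (i : ℕ) ≤ j := hij
    have := hlow i
    have := hlow j
    simp only [Fin.val_rev] at h₁
    dsimp only
    omega
  · have hle : i.rev ≤ ⟨k - 1, by omega⟩ := by
      simp only [Fin.le_def, Fin.val_rev]
      omega
    have h₁ := hmono.add_sub_le_fin hle
    have h₂ := ((hmem _).1 ⟨⟨k - 1, by omega⟩, rfl⟩).1
    have := hlow i
    simp only [Fin.val_rev] at h₁
    dsimp only
    omega
  · ext x
    have hn : (0 : ℤ) < n := by
      have := ((hmem _).1 ⟨⟨0, hk⟩, rfl⟩).1
      omega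
    obtain ⟨r, hr⟩ := Int.eq_ofNat_of_zero_le (Int.emod_nonneg x hn.ne')
    have hlt := Int.emod_lt_of_pos x hn
    rw [← hA.emod_mem x]
    simp only [unroll, Set.mem_ofPred_eq, hpos]
    rw [hr] at hlt ⊢
    have hiff := hmem r
    rw [and_iff_right (by exact_mod_cast hlt)] at hiff
    rw [← hiff]
    constructor
    · rintro ⟨i, hi⟩
      exact ⟨i.rev, by exact_mod_cast hi.symm⟩
    · rintro ⟨i, hi⟩
      exact ⟨i.rev, by rw [Fin.rev_rev, hi]⟩

theorem ncard_orbLen_eq_ncard_minPeriod {k m d : ℕ} (hk : 1 ≤ d * k) (hkm : k ≤ m) :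
    {lam : Fin (d * k) → ℕ |
        IsDiagram (d * k) (d * m) lam ∧ orbLen (d * k) (d * m) lam = m}.ncard =
      {A : Set ℤ | minPeriod A = m ∧ countBelow A m = k}.ncard := by
  have hd : 0 < d := Nat.pos_of_mul_pos_right hk
  have hm : 0 < m := (Nat.pos_of_mul_pos_left hk).trans_le hkm
  have hle : d * k ≤ d * m := Nat.mul_le_mul_left d hkm
  rw [← Set.InjOn.ncard_image ((unroll_injOn hle).mono fun lam h => h.1)]
  congr 1
  ext A
  constructor
  · rintro ⟨lam, ⟨h, horb⟩, rfl⟩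
    have hmin := (minPeriod_unroll h hk hle).trans horb
    refine ⟨hmin, ?_⟩
    have hper := minPeriod_spec (hmin ▸ hm)
    rw [hmin] at hper
    have hcount := countBelow_unroll h hle
    rw [countBelow_mul hper] at hcount
    exact Nat.eq_of_mul_eq_mul_left hd hcount
  · rintro ⟨hmin, hcount⟩
    have hper := minPeriod_spec (hmin ▸ hm)
    rw [hmin] at hper
    obtain ⟨lam, h, rfl⟩ := exists_unroll_eq hk (hper.mul d)
      (by rw [countBelow_mul hper, hcount])
    exact ⟨lam, ⟨h, (minPeriod_unroll h hk hle).symm.trans hmin⟩, rfl⟩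

/-- for every divisor `d` of `gcd(k,n)`, the set of diagrams in
`Y_{k,n}` with `o(λ) = n/d` and the set of diagrams in `Y_{k/d,n/d}` with
`o(μ) = n/d` have the same cardinality. -/
theorem card_orbLen_eq_card_orbLen_div (k n d : ℕ) (hk : 1 ≤ k) (hkn : k ≤ n)
    (hd : d ∣ Nat.gcd k n) :
    {lam : Fin k → ℕ | IsDiagram k n lam ∧ orbLen k n lam = n / d}.ncard =
      {mu : Fin (k / d) → ℕ |
        IsDiagram (k / d) (n / d) mu ∧ orbLen (k / d) (n / d) mu = n / d}.ncard := by
  obtain ⟨k, rfl⟩ := hd.trans (Nat.gcd_dvd_left k n)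
  obtain ⟨m, rfl⟩ := hd.trans (Nat.gcd_dvd_right _ n)
  have hd₀ : 0 < d := Nat.pos_of_mul_pos_right hk
  have hkm : k ≤ m := Nat.le_of_mul_le_mul_left hkn hd₀
  rw [Nat.mul_div_cancel_left m hd₀, Nat.mul_div_cancel_left k hd₀,
    ncard_orbLen_eq_ncard_minPeriod hk hkm]
  have h := ncard_orbLen_eq_ncard_minPeriod (d := 1) (k := k) (m := m)
    (by rw [one_mul]; exact Nat.pos_of_mul_pos_left hk) hkm
  rw [one_mul, one_mul] at h
  exact h.symm
end

section
/- If 1 ≤ k ≤ n and λ ∈ Y_{k,n} is strictly upper triangular, then λ is the unique upper triangular diagram in its σ-orbit: for every integer t with 0 ≤ t < n, if σ^t(λ) is upper triangular then σ^t(λ) = λ. In particular λ is minimal upper triangular. -/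
/-- `mu` is a window, starting at row `r` and shifted by `c`, of the extension of `lam` to a
sequence that decreases by `n - k` every `k` steps. -/
def IsWindow (k n : ℕ) (lam mu : Fin k → ℕ) (r : ℕ) (c : ℤ) : Prop :=
  ∀ i j : Fin k, ((j : ℕ) = r + i → (mu i : ℤ) = lam j + c) ∧
    ((j : ℕ) + k = r + i → (mu i : ℤ) = lam j + c - (n - k : ℕ))

theorem IsWindow.exists_cyc {k n : ℕ} {lam mu : Fin k → ℕ} {r : ℕ} {c : ℤ}
    (h : IsWindow k n lam mu r c) (hr : r < k) (hmu : IsDiagram k n mu) :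
    ∃ r' < k, ∃ c' : ℤ, IsWindow k n lam (cyc k n mu) r' c' := by
  unfold cyc
  split_ifs with hlt
  · refine ⟨r, hr, c + 1, fun i j => ⟨fun hj => ?_, fun hj => ?_⟩⟩
    · have := (h i j).1 hj
      push_cast
      linarith
    · have := (h i j).2 hj
      push_cast
      linarith
  · have hfirst : (lam ⟨r, hr⟩ : ℤ) + c = (n - k : ℕ) := by
      push Not at hlt
      obtain ⟨i, hi⟩ := hlt
      have h0 : mu ⟨0, by omega⟩ = n - k :=
        le_antisymm (hmu.2 _) (hi.trans (hmu.1 _ _ (Fin.mk_le_mk.2 (Nat.zero_le _))))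
      rw [← (h ⟨0, by omega⟩ ⟨r, hr⟩).1 rfl, h0]
    by_cases hr' : r + 1 < k
    · refine ⟨r + 1, hr', c, fun i j => ⟨fun hj => ?_, fun hj => ?_⟩⟩
      · have hi : (i : ℕ) + 1 < k := by omega
        simp only [hi, dif_pos]
        exact (h ⟨i + 1, hi⟩ j).1 (by simp only; omega)
      · by_cases hi : (i : ℕ) + 1 < k
        · simp only [hi, dif_pos]
          exact (h ⟨i + 1, hi⟩ j).2 (by simp only; omega)
        · obtain rfl : j = ⟨r, hr⟩ := Fin.ext (by simp only; omega)
          simp only [hi, dif_neg, not_false_eq_true, hfirst, sub_self, Nat.cast_zero]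
    · refine ⟨0, by omega, c - (n - k : ℕ), fun i j => ⟨fun hj => ?_, fun hj => ?_⟩⟩
      · by_cases hi : (i : ℕ) + 1 < k
        · simp only [hi, dif_pos]
          rw [(h ⟨i + 1, hi⟩ j).2 (by simp only; omega)]
          ring
        · obtain rfl : j = ⟨r, hr⟩ := Fin.ext (by simp only; omega)
          simp only [hi, dif_neg, not_false_eq_true, Nat.cast_zero]
          linarith
      · omega

theorem exists_isWindow_iterate_cyc {k n : ℕ} (hk : 1 ≤ k) {lam : Fin k → ℕ}
    (h : IsDiagram k n lam) (t : ℕ) :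
    ∃ r < k, ∃ c : ℤ, IsWindow k n lam ((cyc k n)^[t] lam) r c := by
  induction t with
  | zero =>
    refine ⟨0, hk, 0, fun i j => ⟨fun hj => ?_, fun hj => by omega⟩⟩
    obtain rfl : j = i := Fin.ext (by omega)
    simp
  | succ t ih =>
    obtain ⟨r, hr, c, hw⟩ := ih
    rw [Function.iterate_succ_apply']
    exact hw.exists_cyc hr (h.iterate_cyc t)

theorem IsUpper.last_eq_zero {k n : ℕ} {lam : Fin k → ℕ} (h : IsUpper k n lam) {i : Fin k}
    (hi : (i : ℕ) = k - 1) : lam i = 0 := by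
  have := h i
  rw [hi, Nat.sub_self, Nat.mul_zero, Nat.le_zero, Nat.mul_eq_zero] at this
  exact this.resolve_left (by omega)

theorem IsWindow.eq_of_isUpper {k n : ℕ} {lam mu : Fin k → ℕ} {r : ℕ} {c : ℤ}
    (h : IsWindow k n lam mu r c) (hr : r < k) (hu : IsUpper k n lam)
    (hs : ∀ i : Fin k, (i : ℕ) < k - 1 → k * lam i < (n - k) * (k - 1 - (i : ℕ)))
    (hmu : IsUpper k n mu) : mu = lam := by
  let z : Fin k := ⟨k - 1, by omega⟩
  have hlz : lam z = 0 := hu.last_eq_zero rfl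
  have hmz : mu z = 0 := hmu.last_eq_zero rfl
  rcases Nat.eq_zero_or_pos r with rfl | hpos
  · have hc := (h z z).1 (by omega)
    rw [hlz, hmz] at hc
    funext i
    have := (h i i).1 (by omega)
    omega
  · exfalso
    have h1 := (h z ⟨r - 1, by omega⟩).2 (by simp only [z]; omega)
    have h2 := (h ⟨k - 1 - r, by omega⟩ z).1 (by simp only [z]; omega)
    have h3 := hs ⟨r - 1, by omega⟩ (by simp only; omega)
    have h4 := hmu ⟨k - 1 - r, by omega⟩
    simp only at h3 h4
    rw [show k - 1 - (r - 1) = k - r by omega] at h3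
    rw [show k - 1 - (k - 1 - r) = r by omega] at h4
    rw [hmz] at h1
    rw [hlz] at h2
    zify [hr.le] at h3 h4
    rw [h2] at h4
    have h5 : (lam ⟨r - 1, by omega⟩ : ℤ) = (n - k : ℕ) - c := by
      push_cast at h1 ⊢
      linarith
    rw [h5] at h3
    push_cast at h3 h4
    nlinarith

/-- a strictly upper triangular diagram is the unique upper
triangular diagram in its `σ`-orbit: for `0 ≤ t < n`, if `σ^t(λ)` is upper
triangular then `σ^t(λ) = λ`. In particular `λ` is minimal upper triangular. -/
theorem strictUpper_unique_in_orbit (k n : ℕ) (hk : 1 ≤ k) (hkn : k ≤ n)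
    (lam : Fin k → ℕ) (hlam : IsDiagram k n lam) (hu : IsUpper k n lam)
    (hs : ∀ i : Fin k, (i : ℕ) < k - 1 → k * lam i < (n - k) * (k - 1 - (i : ℕ))) :
    (∀ t : ℕ, t < n → IsUpper k n ((cyc k n)^[t] lam) → (cyc k n)^[t] lam = lam) ∧
    IsMinUpper k n lam := by
  have key : ∀ t : ℕ, IsUpper k n ((cyc k n)^[t] lam) → (cyc k n)^[t] lam = lam := fun t ht =>
    let ⟨_, hr, _, hw⟩ := exists_isWindow_iterate_cyc hk hlam t
    hw.eq_of_isUpper hr hu hs ht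
  exact ⟨fun t _ => key t, hu, fun t ht => Or.inl (key t ht).symm⟩
end

section
/- For all integers k ≥ 1, m ≥ 1 and n = km: o(θ_{k,km}) = m, and the σ-orbit of θ_{k,km} consists exactly of the m diagrams θ_{k,km} + (t, t, …, t) for 0 ≤ t ≤ m−1. -/
lemma cyc_theta_add_of_lt {k m t : ℕ} (ht : t + 1 < m) :
    cyc k (k * m) (fun i => theta k m i + t) = fun i => theta k m i + (t + 1) := by
  unfold cyc
  rw [if_pos]
  · rfl
  · intro i
    obtain ⟨d, rfl⟩ : ∃ d, m = d + 1 := ⟨m - 1, by omega⟩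
    have hi := i.isLt
    have h : (k - 1 - (i : ℕ) + 1) * d ≤ k * d := Nat.mul_le_mul_right d (by omega)
    have hsub : k * (d + 1) - k = k * d := by rw [Nat.mul_succ, Nat.add_sub_cancel]
    simp only [theta, Nat.add_sub_cancel, hsub]
    rw [Nat.succ_mul] at h
    omega

lemma cyc_theta_add_pred {k m : ℕ} (hk : 1 ≤ k) (hm : 1 ≤ m) :
    cyc k (k * m) (fun i => theta k m i + (m - 1)) = theta k m := by
  obtain ⟨d, rfl⟩ : ∃ d, m = d + 1 := ⟨m - 1, by omega⟩
  unfold cyc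
  rw [if_neg]
  · funext i
    have hi := i.isLt
    simp only [theta, Nat.add_sub_cancel]
    split_ifs with h
    · rw [← Nat.succ_mul]
      congr 1
      omega
    · rw [show k - 1 - (i : ℕ) = 0 by omega, Nat.zero_mul]
  · intro h
    have h0 := h ⟨0, hk⟩
    have hsub : k * (d + 1) - k = k * d := by rw [Nat.mul_succ, Nat.add_sub_cancel]
    simp only [theta, Nat.add_sub_cancel, Nat.sub_zero, hsub, ← Nat.succ_mul] at h0
    rw [Nat.succ_eq_add_one, Nat.sub_add_cancel hk] at h0
    exact lt_irrefl _ h0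

lemma iterate_cyc_theta {k m : ℕ} (hk : 1 ≤ k) (hm : 1 ≤ m) (t : ℕ) :
    (cyc k (k * m))^[t] (theta k m) = fun i => theta k m i + t % m := by
  induction t with
  | zero => simp
  | succ t ih =>
    rw [Function.iterate_succ_apply', ih]
    have hlt := Nat.mod_lt t hm
    rcases Nat.lt_or_ge (t % m + 1) m with h | h
    · rw [cyc_theta_add_of_lt h, ← Nat.mod_add_mod, Nat.mod_eq_of_lt h]
    · rw [show t % m = m - 1 by omega, cyc_theta_add_pred hk hm, ← Nat.mod_add_mod,
        show t % m + 1 = m by omega, Nat.mod_self]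
      rfl

lemma iterate_cyc_theta_eq_self_iff {k m : ℕ} (hk : 1 ≤ k) (hm : 1 ≤ m) (t : ℕ) :
    (cyc k (k * m))^[t] (theta k m) = theta k m ↔ m ∣ t := by
  rw [iterate_cyc_theta hk hm, Nat.dvd_iff_mod_eq_zero]
  constructor
  · intro h
    simpa using congrFun h ⟨0, hk⟩
  · intro h
    simp [h]

/-- for `n = km`, `o(θ_{k,km}) = m`, and the `σ`-orbit of
`θ_{k,km}` consists exactly of the `m` diagrams `θ_{k,km} + (t,…,t)` for
`0 ≤ t ≤ m-1`. -/
theorem orbLen_theta_and_orbit (k m : ℕ) (hk : 1 ≤ k) (hm : 1 ≤ m) :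
    orbLen k (k * m) (theta k m) = m ∧
    {lam : Fin k → ℕ | ∃ t : ℕ, (cyc k (k * m))^[t] (theta k m) = lam} =
      {lam : Fin k → ℕ | ∃ t < m, lam = fun i => theta k m i + t} := by
  constructor
  · have h : IsLeast {t | 0 < t ∧ (cyc k (k * m))^[t] (theta k m) = theta k m} m :=
      ⟨⟨hm, (iterate_cyc_theta_eq_self_iff hk hm m).2 dvd_rfl⟩, fun t ht =>
        Nat.le_of_dvd ht.1 ((iterate_cyc_theta_eq_self_iff hk hm t).1 ht.2)⟩
    exact h.csInf_eq
  · ext lam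
    constructor
    · rintro ⟨t, rfl⟩
      exact ⟨t % m, Nat.mod_lt t hm, iterate_cyc_theta hk hm t⟩
    · rintro ⟨t, ht, rfl⟩
      exact ⟨t, by rw [iterate_cyc_theta hk hm, Nat.mod_eq_of_lt ht]⟩
end

section
/- Let m ≥ 1 be an integer and n = 3m. A diagram λ ∈ Y_{3,3m} is upper triangular but not minimal upper triangular if and only if λ = (2(m−1), i, 0) for some integer i with 0 ≤ i ≤ m−2. -/
theorem cyc_three_of_lt {n a b c : ℕ} (ha : a < n - 3) (hb : b ≤ a) (hc : c ≤ b) :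
    cyc 3 n ![a, b, c] = ![a + 1, b + 1, c + 1] := by
  have h : ∀ i, ![a, b, c] i < n - 3 := by
    intro i
    fin_cases i <;> simp <;> omega
  rw [cyc, if_pos h]
  funext i
  fin_cases i <;> rfl

theorem cyc_three_of_le {n a b c : ℕ} (ha : n - 3 ≤ a) :
    cyc 3 n ![a, b, c] = ![b, c, 0] := by
  have h : ¬ ∀ i, ![a, b, c] i < n - 3 := fun h => absurd (h 0) (by simpa using ha)
  rw [cyc, if_neg h]
  funext i
  fin_cases i <;> rfl

theorem isUpper_three_iff {m a b c : ℕ} :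
    IsUpper 3 (3 * m) ![a, b, c] ↔ a ≤ 2 * (m - 1) ∧ b ≤ m - 1 ∧ c = 0 := by
  simp only [IsUpper, Fin.forall_fin_succ, IsEmpty.forall_iff]
  simp
  omega

theorem lexLE_three_iff {a b c x y z : ℕ} :
    lexLE ![a, b, c] ![x, y, z] ↔
      a < x ∨ a = x ∧ (b < y ∨ b = y ∧ c ≤ z) := by
  have h : (![a, b, c] = ![x, y, z]) ↔ a = x ∧ b = y ∧ c = z := by
    simp
  rw [lexLE, h]
  simp [Fin.exists_fin_succ, Fin.forall_fin_succ]
  omega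

theorem iterate_cyc_three_of_le {n a b c : ℕ} (hb : b ≤ a) (hc : c ≤ b) (t : ℕ)
    (ht : a + t ≤ n - 3) :
    (cyc 3 n)^[t] ![a, b, c] = ![a + t, b + t, c + t] := by
  induction t with
  | zero => rfl
  | succ t ih =>
    rw [Function.iterate_succ_apply', ih (by omega),
      cyc_three_of_lt (by omega) (by omega) (by omega)]
    rfl

/-- The orbit of `(a, b, 0)` under the cyclic step consists of vertical translates of three
diagrams with vanishing last row. -/
theorem exists_iterate_cyc_three_eq {n a b : ℕ} (hb : b ≤ a) (ha : a ≤ n - 3) (t : ℕ) :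
    ∃ x y z : ℕ, (cyc 3 n)^[t] ![a, b, 0] = ![x, y, z] ∧ z ≤ y ∧ y ≤ x ∧ x ≤ n - 3 ∧
      (x = a + z ∧ y = b + z ∨ x + a = n - 3 + b + z ∧ y + a = n - 3 + z ∨
        x + b = n - 3 + z ∧ y + b = a + z) := by
  induction t with
  | zero => exact ⟨a, b, 0, rfl, by omega⟩
  | succ t ih =>
    obtain ⟨x, y, z, h, hzy, hyx, hx, hor⟩ := ih
    rw [Function.iterate_succ_apply', h]
    rcases lt_or_ge x (n - 3) with hlt | hge
    · exact ⟨x + 1, y + 1, z + 1, cyc_three_of_lt hlt hyx hzy, by omega⟩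
    · exact ⟨y, z, 0, cyc_three_of_le hge, by omega⟩

/-- for `n = 3m`, a diagram `λ ∈ Y_{3,3m}` is upper triangular but
not minimal upper triangular iff `λ = (2(m-1), i, 0)` for some `0 ≤ i ≤ m-2`. -/
theorem upper_not_minUpper_iff (m : ℕ) (hm : 1 ≤ m) (lam : Fin 3 → ℕ)
    (hlam : IsDiagram 3 (3 * m) lam) :
    (IsUpper 3 (3 * m) lam ∧ ¬ IsMinUpper 3 (3 * m) lam) ↔
      ∃ i : ℕ, i + 2 ≤ m ∧ lam = ![2 * (m - 1), i, 0] := by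
  constructor
  · rintro ⟨hup, hmin⟩
    obtain ⟨a, b, c, rfl⟩ : ∃ a b c, lam = ![a, b, c] :=
      ⟨lam 0, lam 1, lam 2, by funext i; fin_cases i <;> rfl⟩
    have hba : b ≤ a := hlam.1 0 1 (by decide)
    obtain ⟨ha, hb, rfl⟩ := isUpper_three_iff.1 hup
    by_contra hne
    refine hmin ⟨hup, fun t ht => ?_⟩
    have hne' : ¬ (a = 2 * (m - 1) ∧ b + 2 ≤ m) := by
      rintro ⟨rfl, h⟩
      exact hne ⟨b, h, rfl⟩
    obtain ⟨x, y, z, h, hzy, hyx, hx, hor⟩ :=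
      exists_iterate_cyc_three_eq (n := 3 * m) hba (by omega) t
    rw [h] at ht ⊢
    rw [isUpper_three_iff] at ht
    rw [lexLE_three_iff]
    omega
  · rintro ⟨i, hi, rfl⟩
    refine ⟨isUpper_three_iff.2 (by omega), fun hmin => ?_⟩
    have h : (cyc 3 (3 * m))^[m - 1 + 1] ![2 * (m - 1), i, 0] =
        ![i + (m - 1), 0 + (m - 1), 0] := by
      rw [Function.iterate_succ_apply',
        iterate_cyc_three_of_le (by omega) (by omega) _ (by omega),
        cyc_three_of_le (by omega)]
    have hle := hmin.2 (m - 1 + 1)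
    rw [h, isUpper_three_iff, lexLE_three_iff] at hle
    omega
end

section
/- Let 1 ≤ k ≤ n, let μ, ν ∈ Y_{k,n} both be minimal upper triangular, and let t be an integer with 0 < t ≤ o(ν) such that σ^t(μ) = ν. Then μ = ν and t = o(ν). -/
theorem IsDiagram.apply_zero_of_not_lt {k n : ℕ} {lam : Fin k → ℕ} (hk : 0 < k)
    (h : IsDiagram k n lam) (hlam : ¬ ∀ i, lam i < n - k) : lam ⟨0, hk⟩ = n - k := by
  push Not at hlam
  obtain ⟨i, hi⟩ := hlam
  exact le_antisymm (h.2 _) (hi.trans (h.1 _ _ (Fin.mk_le_mk.2 (Nat.zero_le _))))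

theorem cyc_injOn {k n : ℕ} (hk : 0 < k) :
    Set.InjOn (cyc k n) {lam | IsDiagram k n lam} := by
  intro a ha b hb hab
  have hlast : ¬ (k - 1 + 1 < k) := by omega
  unfold cyc at hab
  split_ifs at hab with h₁ h₂ h₂
  · funext i
    exact Nat.succ_injective (congrFun hab i)
  · simpa [hlast] using congrFun hab ⟨k - 1, by omega⟩
  · simpa [hlast] using congrFun hab ⟨k - 1, by omega⟩
  · funext ⟨i, hi⟩
    cases i with
    | zero =>
      rw [ha.apply_zero_of_not_lt hk h₁, hb.apply_zero_of_not_lt hk h₂]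
    | succ i => simpa [hi] using congrFun hab ⟨i, by omega⟩

theorem finite_setOf_isDiagram (k n : ℕ) : {lam | IsDiagram k n lam}.Finite :=
  (Set.Finite.pi' fun _ : Fin k => Set.finite_Iic (n - k)).subset fun _ h => h.2

theorem IsDiagram.exists_cyc_iterate_eq {k n : ℕ} {lam : Fin k → ℕ} (hk : 0 < k)
    (h : IsDiagram k n lam) : ∃ p, 0 < p ∧ (_root_.cyc k n)^[p] lam = lam := by
  have hmaps : Set.MapsTo (_root_.cyc k n) {lam | IsDiagram k n lam} {lam | IsDiagram k n lam} :=
    fun _ h => IsDiagram.cyc h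
  have := (finite_setOf_isDiagram k n).to_subtype
  obtain ⟨p, hp, hper⟩ :=
    (hmaps.restrict_inj.2 (cyc_injOn hk)).mem_periodicPts ⟨lam, h⟩
  refine ⟨p, hp, ?_⟩
  have := hper.eq
  rw [hmaps.iterate_restrict] at this
  exact congrArg Subtype.val this

theorem lexLE.antisymm {k : ℕ} {lam mu : Fin k → ℕ} (h₁ : lexLE lam mu) (h₂ : lexLE mu lam) :
    lam = mu := by
  rcases h₁ with h₁ | ⟨s, hs, hs'⟩
  · exact h₁
  rcases h₂ with h₂ | ⟨t, ht, ht'⟩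
  · exact h₂.symm
  rcases lt_trichotomy s t with hst | rfl | hst
  · have := ht s hst
    omega
  · omega
  · have := hs t hst
    omega

/-- if `μ, ν ∈ Y_{k,n}` are both minimal upper triangular and
`σ^t(μ) = ν` for some `0 < t ≤ o(ν)`, then `μ = ν` and `t = o(ν)`. -/
theorem minUpper_shift_eq (k n : ℕ) (hk : 1 ≤ k) (hkn : k ≤ n)
    (mu nu : Fin k → ℕ) (hmu : IsDiagram k n mu) (hnu : IsDiagram k n nu)
    (hmmu : IsMinUpper k n mu) (hmnu : IsMinUpper k n nu)
    (t : ℕ) (ht0 : 0 < t) (ht1 : t ≤ orbLen k n nu)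
    (hst : (cyc k n)^[t] mu = nu) :
    mu = nu ∧ t = orbLen k n nu := by
  obtain ⟨p, hp, hper⟩ := hmu.exists_cyc_iterate_eq hk
  have hback : (cyc k n)^[t * (p - 1)] nu = mu := by
    have hmul : t * (p - 1) + t = p * t := by
      rw [← Nat.mul_succ, Nat.succ_eq_add_one, Nat.sub_add_cancel hp, Nat.mul_comm]
    rw [← hst, ← Function.iterate_add_apply, hmul, Function.iterate_mul]
    exact Function.iterate_fixed hper t
  have heq : mu = nu := by
    apply lexLE.antisymm
    · simpa only [hst] using hmmu.2 t (hst.symm ▸ hmnu.1)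
    · have := hmnu.2 (t * (p - 1)) (by rw [hback]; exact hmmu.1)
      rwa [hback] at this
  subst heq
  exact ⟨rfl, le_antisymm ht1 (Nat.sInf_le ⟨ht0, hst⟩)⟩
end
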